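/- Parallel velocity alignment across a non-characteristic interface: assume the Rankine–Hugoniot relation holds, π_I > 0, π_II > 0, and W_I ≠ Z. Then W_II ≠ Z and cosh(W_I − Z)(1+|u∥_I|²)^{1/2} u∥_II = cosh(W_II − Z)(1+|u∥_II|²)^{1/2} u∥_I as vectors in ℝ^{d−1}. -/

import Mathlib

open Real

/-- Squared Euclidean norm of a vector. -/
noncomputable def nsq {n : ℕ} (w : Fin n → ℝ) : ℝ := ∑ j, (w j) ^ 2

/-- Minkowski bilinear form on `ℝ^{d+1}`: `η(x,y) = -x₀y₀ + ∑_{j=1}^d xⱼyⱼ`. -/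
noncomputable def eta {d : ℕ} (x y : Fin (d + 1) → ℝ) : ℝ :=
  -(x 0 * y 0) + ∑ j : Fin d, x j.succ * y j.succ

/-- Unit spacelike normal `V = (sinh Z, cosh Z, 0, …, 0)` to the interface. -/
noncomputable def normalV (d : ℕ) (Z : ℝ) : Fin (d + 1) → ℝ := fun i =>
  if i.val = 0 then Real.sinh Z else if i.val = 1 then Real.cosh Z else 0

/-- Unit timelike fluid velocity determined by the perpendicular rapidity `W` and
the parallel velocity `w ∈ ℝ^{d-1}`. -/
noncomputable def vel (d : ℕ) (W : ℝ) (w : Fin (d - 1) → ℝ) : Fin (d + 1) → ℝ := fun i =>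
  if i.val = 0 then Real.sqrt (1 + nsq w) * Real.cosh W
  else if i.val = 1 then Real.sqrt (1 + nsq w) * Real.sinh W
  else if h : i.val - 2 < d - 1 then w ⟨i.val - 2, h⟩ else 0

/-- The Rankine–Hugoniot relation
`(μ_II + p_II) η(u_II,V) u_II − (μ_I + p_I) η(u_I,V) u_I + (p_II − p_I) V = 0`. -/
def RH (d : ℕ) (μI pI μII pII : ℝ) (uI uII V : Fin (d + 1) → ℝ) : Prop :=
  ∀ i, (μII + pII) * eta uII V * uII i - (μI + pI) * eta uI V * uI i + (pII - pI) * V i = 0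

theorem one_add_nsq_pos {n : ℕ} (w : Fin n → ℝ) : 0 < 1 + nsq w := by
  have : 0 ≤ nsq w := Finset.sum_nonneg fun j _ => sq_nonneg (w j)
  linarith

theorem eta_vel_normalV {d : ℕ} (hd : 1 ≤ d) (W Z : ℝ) (w : Fin (d - 1) → ℝ) :
    eta (vel d W w) (normalV d Z) = √(1 + nsq w) * sinh (W - Z) := by
  obtain ⟨n, rfl⟩ := Nat.exists_eq_add_of_le' hd
  simp only [eta, Fin.sum_univ_succ]
  simp [vel, normalV, sinh_sub]
  ring

/-- Boosting the Rankine–Hugoniot relation to the interface frame: the component tangent to the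
interface in the time direction. -/
theorem RH.time_component {d : ℕ} (hd : 1 ≤ d) {Z μI μII pI pII WI WII : ℝ}
    {wI wII : Fin (d - 1) → ℝ}
    (h : RH d μI pI μII pII (vel d WI wI) (vel d WII wII) (normalV d Z)) :
    (μII + pII) * eta (vel d WII wII) (normalV d Z) * (√(1 + nsq wII) * cosh (WII - Z)) =
      (μI + pI) * eta (vel d WI wI) (normalV d Z) * (√(1 + nsq wI) * cosh (WI - Z)) := by
  have h₀ := h 0
  have h₁ := h ⟨1, by omega⟩
  generalize eta (vel d WII wII) (normalV d Z) = e at *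
  generalize eta (vel d WI wI) (normalV d Z) = f at *
  simp only [vel, normalV, Fin.val_zero, if_true, one_ne_zero, if_false] at h₀ h₁
  rw [cosh_sub, cosh_sub]
  linear_combination cosh Z * h₀ - sinh Z * h₁

theorem RH.parallel_component {d : ℕ} {Z μI μII pI pII WI WII : ℝ}
    {wI wII : Fin (d - 1) → ℝ}
    (h : RH d μI pI μII pII (vel d WI wI) (vel d WII wII) (normalV d Z)) (j : Fin (d - 1)) :
    (μII + pII) * eta (vel d WII wII) (normalV d Z) * wII j =
      (μI + pI) * eta (vel d WI wI) (normalV d Z) * wI j := by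
  have hj := h ⟨j + 2, by omega⟩
  generalize eta (vel d WII wII) (normalV d Z) = e at *
  generalize eta (vel d WI wI) (normalV d Z) = f at *
  simp [vel, normalV] at hj
  linear_combination hj

/-- Parallel velocity alignment across a non-characteristic interface. -/
theorem parallel_velocity_alignment (d : ℕ) (hd : 2 ≤ d) (Z μI μII pI pII WI WII : ℝ)
    (wI wII : Fin (d - 1) → ℝ) (hμI : 0 ≤ μI) (hμII : 0 ≤ μII)
    (hπI : 0 < (μI + pI) * (1 + nsq wI)) (hπII : 0 < (μII + pII) * (1 + nsq wII))
    (hW : WI ≠ Z)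
    (hRH : RH d μI pI μII pII (vel d WI wI) (vel d WII wII) (normalV d Z)) :
    WII ≠ Z ∧
    ∀ j : Fin (d - 1),
      Real.cosh (WI - Z) * Real.sqrt (1 + nsq wI) * wII j
        = Real.cosh (WII - Z) * Real.sqrt (1 + nsq wII) * wI j := by
  have hd₁ : 1 ≤ d := by omega
  have htime := hRH.time_component hd₁
  have hpar := hRH.parallel_component
  have hsI : 0 < √(1 + nsq wI) := sqrt_pos.2 (one_add_nsq_pos wI)
  have hfluxI : (μI + pI) * eta (vel d WI wI) (normalV d Z) ≠ 0 := by
    rw [eta_vel_normalV hd₁]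
    exact mul_ne_zero (left_ne_zero_of_mul hπI.ne')
      (mul_ne_zero hsI.ne' (sinh_ne_zero.2 (sub_ne_zero.2 hW)))
  have hfluxII : (μII + pII) * eta (vel d WII wII) (normalV d Z) ≠ 0 := fun h0 => by
    rw [h0, zero_mul] at htime
    exact mul_ne_zero hfluxI (mul_pos hsI (cosh_pos _)).ne' htime.symm
  refine ⟨?_, fun j => mul_left_cancel₀ hfluxII ?_⟩
  · rintro rfl
    simp [eta_vel_normalV hd₁] at hfluxII
  · linear_combination cosh (WI - Z) * √(1 + nsq wI) * hpar j - wI j * htime
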